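/- Fix p > 0 and define f(q) := q·e^q·(e^p − 1)/((q − p)·e^p·(e^q − 1)) − p/(q − p) for q > p. Then f is monotonically increasing on (p, ∞), and in particular f(q) ≥ (e^p − p − 1)/(e^p − 1) for all q > p. -/

import Mathlib

lemma sub_two_mul_exp_add_pos {x : ℝ} (hx : 0 < x) : 0 < (x - 2) * Real.exp x + x + 2 := by
  have hd : ∀ y : ℝ, HasDerivAt (fun y : ℝ => (y - 2) * Real.exp y + y + 2)
      (1 * Real.exp y + (y - 2) * Real.exp y + 1) y := fun y =>
    (((((hasDerivAt_id y).sub_const 2).mul (Real.hasDerivAt_exp y)).add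
      (hasDerivAt_id y)).add_const 2)
  have hmono : StrictMonoOn (fun y : ℝ => (y - 2) * Real.exp y + y + 2) (Set.Ici 0) := by
    refine strictMonoOn_of_deriv_pos (convex_Ici 0) (by fun_prop) fun y hy => ?_
    rw [interior_Ici, Set.mem_Ioi] at hy
    rw [(hd y).deriv]
    have h1 := Real.add_one_lt_exp (neg_ne_zero.mpr hy.ne')
    have h2 := mul_lt_mul_of_pos_right h1 (Real.exp_pos y)
    rw [← Real.exp_add, neg_add_cancel, Real.exp_zero] at h2
    linarith
  have h := hmono (Set.mem_Ici.mpr le_rfl) (Set.mem_Ici.mpr hx.le) hx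
  simpa using h

lemma exp_sub_one_pos {x : ℝ} (hx : 0 < x) : 0 < Real.exp x - 1 :=
  sub_pos.mpr (Real.one_lt_exp_iff.mpr hx)

lemma hasDerivAt_mul_exp_div_exp_sub_one {x : ℝ} (hx : 0 < x) :
    HasDerivAt (fun y : ℝ => y * Real.exp y / (Real.exp y - 1))
      (Real.exp x * (Real.exp x - 1 - x) / (Real.exp x - 1) ^ 2) x := by
  have h := ((hasDerivAt_id x).mul (Real.hasDerivAt_exp x)).div
    ((Real.hasDerivAt_exp x).sub_const 1) (exp_sub_one_pos hx).ne'
  refine h.congr_deriv ?_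
  simp only [id, Pi.mul_apply]
  ring

lemma hasDerivAt_exp_mul_div_exp_sub_one_sq {x : ℝ} (hx : 0 < x) :
    HasDerivAt (fun y : ℝ => Real.exp y * (Real.exp y - 1 - y) / (Real.exp y - 1) ^ 2)
      (Real.exp x * ((x - 2) * Real.exp x + x + 2) / (Real.exp x - 1) ^ 3) x := by
  have hne := (exp_sub_one_pos hx).ne'
  have h := ((Real.hasDerivAt_exp x).mul
    (((Real.hasDerivAt_exp x).sub_const 1).sub (hasDerivAt_id x))).div
    (((Real.hasDerivAt_exp x).sub_const 1).pow 2) (pow_ne_zero 2 hne)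
  refine h.congr_deriv ?_
  simp only [id, Pi.mul_apply, Pi.sub_apply, Pi.pow_apply]
  field_simp
  ring

lemma strictConvexOn_mul_exp_div_exp_sub_one :
    StrictConvexOn ℝ (Set.Ioi 0) (fun y : ℝ => y * Real.exp y / (Real.exp y - 1)) := by
  refine StrictMonoOn.strictConvexOn_of_deriv (convex_Ioi 0)
    (fun y hy => (hasDerivAt_mul_exp_div_exp_sub_one hy).continuousAt.continuousWithinAt) ?_
  rw [interior_Ioi]
  have hmono : StrictMonoOn
      (fun y : ℝ => Real.exp y * (Real.exp y - 1 - y) / (Real.exp y - 1) ^ 2) (Set.Ioi 0) := by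
    refine strictMonoOn_of_deriv_pos (convex_Ioi 0)
      (fun y hy => (hasDerivAt_exp_mul_div_exp_sub_one_sq hy).continuousAt.continuousWithinAt)
      fun y hy => ?_
    rw [interior_Ioi, Set.mem_Ioi] at hy
    rw [(hasDerivAt_exp_mul_div_exp_sub_one_sq hy).deriv]
    have h1 := sub_two_mul_exp_add_pos hy
    have h2 := exp_sub_one_pos hy
    positivity
  exact hmono.congr fun y hy => (hasDerivAt_mul_exp_div_exp_sub_one hy).deriv.symm

lemma ratio_eq_mul_secant {p q : ℝ} (hp : 0 < p) (hpq : p < q) :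
    q * Real.exp q * (Real.exp p - 1) / ((q - p) * Real.exp p * (Real.exp q - 1)) - p / (q - p) =
      (Real.exp p - 1) / Real.exp p *
        ((q * Real.exp q / (Real.exp q - 1) - p * Real.exp p / (Real.exp p - 1)) / (q - p)) := by
  have h1 := (exp_sub_one_pos hp).ne'
  have h2 := (exp_sub_one_pos (hp.trans hpq)).ne'
  have h3 := (sub_pos.mpr hpq).ne'
  field_simp


/-- From the proof of Lemma A.3: for fixed `p > 0`, the function
`f(q) = q·e^q·(e^p − 1)/((q − p)·e^p·(e^q − 1)) − p/(q − p)` is monotonically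
increasing on `(p, ∞)`, and in particular `f(q) ≥ (e^p − p − 1)/(e^p − 1)` for
all `q > p`. -/
theorem ratio_monotone_and_lower_bound (p : ℝ) (hp : 0 < p) :
    StrictMonoOn
      (fun q : ℝ =>
        q * Real.exp q * (Real.exp p - 1) / ((q - p) * Real.exp p * (Real.exp q - 1)) -
          p / (q - p))
      (Set.Ioi p) ∧
    ∀ q : ℝ, p < q →
      q * Real.exp q * (Real.exp p - 1) / ((q - p) * Real.exp p * (Real.exp q - 1)) -
          p / (q - p) ≥ (Real.exp p - p - 1) / (Real.exp p - 1) := by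
  have hc : 0 < (Real.exp p - 1) / Real.exp p := div_pos (exp_sub_one_pos hp) (Real.exp_pos p)
  refine ⟨fun x hx y hy hxy => ?_, fun q hq => ?_⟩
  · rw [Set.mem_Ioi] at hx hy
    simp only [ratio_eq_mul_secant hp hx, ratio_eq_mul_secant hp hy]
    exact mul_lt_mul_of_pos_left (strictConvexOn_mul_exp_div_exp_sub_one.secant_strict_mono
      hp (hp.trans hx) (hp.trans hy) hx.ne' hy.ne' hxy) hc
  · rw [ratio_eq_mul_secant hp hq, ge_iff_le]
    have h := strictConvexOn_mul_exp_div_exp_sub_one.convexOn.le_slope_of_hasDerivAt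
      hp (hp.trans hq) hq (hasDerivAt_mul_exp_div_exp_sub_one hp)
    rw [slope_def_field] at h
    refine le_trans (le_of_eq ?_) (mul_le_mul_of_nonneg_left h hc.le)
    have h1 := (exp_sub_one_pos hp).ne'
    field_simp
    ring
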